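/- arXiv:1210.0219 — 3 statements merged into one kernel-verified Lean document; each statement's English description precedes it below -/
import Mathlib

section
/- Let a, b, c, t be real numbers with a ≥ b ≥ c > 0 and t > 0. Then c·sinh(tc)·sinh(ta)·sinh(tb) − cosh(tc)·(a·cosh(ta)·sinh(tb) + b·cosh(tb)·sinh(ta)) ≤ −b·sinh(t(a+b−c)) − b·sinh(tc)·cosh(ta)·cosh(tb). -/
open Real

theorem hexagon_u_upper_bound (a b c t : ℝ) (hab : a ≥ b) (hbc : b ≥ c) (hc : c > 0)
    (ht : t > 0) :
    c * sinh (t * c) * sinh (t * a) * sinh (t * b) -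
      cosh (t * c) * (a * cosh (t * a) * sinh (t * b) + b * cosh (t * b) * sinh (t * a)) ≤
    -(b * sinh (t * (a + b - c))) - b * sinh (t * c) * cosh (t * a) * cosh (t * b) := by
  have hb : b > 0 := by linarith
  have ha : a > 0 := by linarith
  have sA : 0 ≤ sinh (t * a) := Real.sinh_nonneg_iff.2 (by positivity)
  have sB : 0 ≤ sinh (t * b) := Real.sinh_nonneg_iff.2 (by positivity)
  have sC : 0 ≤ sinh (t * c) := Real.sinh_nonneg_iff.2 (by positivity)
  have cA := (Real.cosh_pos (t * a)).le
  have cC := (Real.cosh_pos (t * c)).le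
  have e : t * (a + b - c) = t * a + t * b - t * c := by ring
  rw [e, Real.sinh_sub, Real.sinh_add, Real.cosh_add]
  have h1 : 0 ≤ (b - c) * (sinh (t * a) * sinh (t * b) * sinh (t * c)) :=
    mul_nonneg (by linarith) (by positivity)
  have h2 : 0 ≤ (a - b) * (cosh (t * c) * cosh (t * a) * sinh (t * b)) :=
    mul_nonneg (by linarith) (by positivity)
  linarith
end

section
/- Let a, b, c be real numbers with a ≥ b ≥ c > 0. Then the function f(t) = cosh(tc)/(sinh(ta)·sinh(tb)) is strictly decreasing on the interval (0,∞). -/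
open Real

theorem hexagon_f_strictAnti (a b c : ℝ) (hab : a ≥ b) (hbc : b ≥ c) (hc : c > 0) :
    StrictAntiOn (fun t : ℝ => cosh (t * c) / (sinh (t * a) * sinh (t * b)))
      (Set.Ioi (0 : ℝ)) := by
  intro s hs t ht hst
  have hs : 0 < s := hs
  have ht : 0 < t := ht
  have hb : 0 < b := by linarith
  have ha : 0 < a := by linarith
  have hsa : 0 < sinh (s * a) := sinh_pos_iff.2 (by positivity)
  have hsb : 0 < sinh (s * b) := sinh_pos_iff.2 (by positivity)
  have hta : 0 < sinh (t * a) := sinh_pos_iff.2 (by positivity)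
  have htb : 0 < sinh (t * b) := sinh_pos_iff.2 (by positivity)
  have hlt : sinh (s * a) < sinh (t * a) := sinh_lt_sinh.2 (by nlinarith)
  have h1 : sinh (s * b + t * c) ≤ sinh (t * b + s * c) := sinh_le_sinh.2 (by nlinarith)
  have h2 : sinh (s * b - t * c) ≤ sinh (t * b - s * c) := sinh_le_sinh.2 (by nlinarith)
  rw [sinh_add, sinh_add] at h1
  rw [sinh_sub, sinh_sub] at h2
  have key : cosh (t * c) * sinh (s * b) ≤ cosh (s * c) * sinh (t * b) := by linarith
  have hcs := cosh_pos (s * c)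
  show cosh (t * c) / (sinh (t * a) * sinh (t * b)) < cosh (s * c) / (sinh (s * a) * sinh (s * b))
  rw [div_lt_div_iff₀ (by positivity) (by positivity)]
  calc cosh (t * c) * (sinh (s * a) * sinh (s * b))
      = (cosh (t * c) * sinh (s * b)) * sinh (s * a) := by ring
    _ ≤ (cosh (s * c) * sinh (t * b)) * sinh (s * a) := by gcongr
    _ < (cosh (s * c) * sinh (t * b)) * sinh (t * a) := by gcongr
    _ = _ := by ring
end

section
/- Let a, b, c be real numbers with a ≥ b ≥ c > 0. Then the function g(t) = (cosh(tc) + cosh(ta)·cosh(tb))/(sinh(ta)·sinh(tb)) is strictly decreasing on the interval (0,∞). -/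
open Real

lemma hex_aux (b c s t : ℝ) (hbc : c ≤ b) (hc : 0 < c) (hs : 0 < s) (hst : s < t) :
    cosh (t * c) / sinh (t * b) < cosh (s * c) / sinh (s * b) := by
  have hb : 0 < b := by linarith
  have h1 : 0 < sinh (t * b) := sinh_pos_iff.2 (mul_pos (by linarith) hb)
  have h2 : 0 < sinh (s * b) := sinh_pos_iff.2 (mul_pos hs hb)
  rw [div_lt_div_iff₀ h1 h2]
  have e1 : sinh (s * b + t * c) ≤ sinh (t * b + s * c) := sinh_le_sinh.2 (by nlinarith)
  have e2 : sinh (s * b - t * c) < sinh (t * b - s * c) := sinh_lt_sinh.2 (by nlinarith)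
  rw [sinh_add, sinh_add] at e1
  rw [sinh_sub, sinh_sub] at e2
  nlinarith

theorem hexagon_coshC_strictAnti (a b c : ℝ) (hab : a ≥ b) (hbc : b ≥ c) (hc : c > 0) :
    StrictAntiOn
      (fun t : ℝ => (cosh (t * c) + cosh (t * a) * cosh (t * b)) / (sinh (t * a) * sinh (t * b)))
      (Set.Ioi (0 : ℝ)) := by
  intro s hs t ht hst
  have hs : 0 < s := hs
  have ht : 0 < t := ht
  have hb : 0 < b := by linarith
  have ha : 0 < a := by linarith
  have key : ∀ u : ℝ, (cosh (u * c) + cosh (u * a) * cosh (u * b)) / (sinh (u * a) * sinh (u * b))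
      = (cosh (u * c) / sinh (u * b)) * (1 / sinh (u * a))
        + (cosh (u * a) / sinh (u * a)) * (cosh (u * b) / sinh (u * b)) := by
    intro u
    rw [div_mul_div_comm, div_mul_div_comm, add_div, mul_one, mul_comm (sinh (u * b))]
  have p1 : 0 < sinh (t * a) := sinh_pos_iff.2 (mul_pos ht ha)
  have p2 : 0 < sinh (s * a) := sinh_pos_iff.2 (mul_pos hs ha)
  have p3 : 0 < sinh (t * b) := sinh_pos_iff.2 (mul_pos ht hb)
  have p4 : 0 < sinh (s * b) := sinh_pos_iff.2 (mul_pos hs hb)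
  have q : 1 / sinh (t * a) < 1 / sinh (s * a) :=
    one_div_lt_one_div_of_lt p2 (sinh_lt_sinh.2 (by nlinarith))
  have c1 := cosh_pos (t * a)
  have c2 := cosh_pos (t * b)
  have c3 := cosh_pos (t * c)
  show _ / _ < _ / _
  rw [key s, key t]
  exact add_lt_add
    (mul_lt_mul'' (hex_aux b c s t hbc hc hs hst) q (by positivity) (by positivity))
    (mul_lt_mul'' (hex_aux a a s t le_rfl ha hs hst) (hex_aux b b s t le_rfl hb hs hst)
      (by positivity) (by positivity))
end
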